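/- arXiv:1801.05015 — 2 statements merged into one kernel-verified Lean document; each statement's English description precedes it below -/
import Mathlib

section
/- There exist an entropy function 𝕊 and a set 𝒬 of components of content on 𝒮 with the following properties: (a) 𝕊(a + b) = 𝕊(a) + 𝕊(b) for all states a, b; (b) Q(a + b) = Q(a) + Q(b) for all states a, b and every Q ∈ 𝒬; (c) for all states a, b, a → b if and only if 𝕊(a) ≤ 𝕊(b) and Q(a) = Q(b) for every Q ∈ 𝒬; (d) 𝕊(m) = 0 for every mechanical state m. -/
structure EidoSys where
  State : Type
  [decEq : DecidableEq State]
  Eido : Set (Finset State)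
  pair : State → State → State
  Sim : Finset State → Finset State → Prop
  Arrow : Finset State → Finset State → Prop
  pair_inj : ∀ a b a' b', pair a b = pair a' b' → a = a' ∧ b = b'
  eido_nonempty : ∀ A ∈ Eido, A.Nonempty
  singleton_mem : ∀ a : State, ({a} : Finset State) ∈ Eido
  comb_mem : ∀ A B : Finset State, Finset.image₂ pair A B ∈ Eido ↔ A ∈ Eido ∧ B ∈ Eido
  subset_mem : ∀ A B : Finset State, A ∈ Eido → B ⊆ A → B.Nonempty → B ∈ Eido
  sim_refl : ∀ A : Finset State, Sim A A
  sim_symm : ∀ A B : Finset State, Sim A B → Sim B A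
  sim_trans : ∀ A B C : Finset State, Sim A B → Sim B C → Sim A C
  sim_comm : ∀ A B : Finset State, Sim (Finset.image₂ pair A B) (Finset.image₂ pair B A)
  sim_assoc : ∀ A B C : Finset State,
    Sim (Finset.image₂ pair (Finset.image₂ pair A B) C) (Finset.image₂ pair A (Finset.image₂ pair B C))
  sim_congr : ∀ A B C : Finset State, Sim A B → Sim (Finset.image₂ pair A C) (Finset.image₂ pair B C)
  arrow_of_sim : ∀ A B : Finset State, A ∈ Eido → B ∈ Eido → Sim A B → Arrow A B
  arrow_trans : ∀ A B C : Finset State, Arrow A B → Arrow B C → Arrow A C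
  arrow_comb : ∀ A B C : Finset State, Arrow A B → Arrow (Finset.image₂ pair A C) (Finset.image₂ pair B C)
  arrow_cancel : ∀ (A B : Finset State) (s : State),
    Arrow (Finset.image₂ pair A {s}) (Finset.image₂ pair B {s}) → Arrow A B
  arrow_nsubset : ∀ A B : Finset State, A ∈ Eido → B ∈ Eido → B ⊂ A → ¬ Arrow A B
  arrow_subset_single : ∀ (A A' : Finset State) (b : State),
    A ∈ Eido → A' ⊆ A → A'.Nonempty → Arrow A {b} → Arrow A' {b}
  arrow_union : ∀ A₁ A₂ B₁ B₂ : Finset State,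
    A₁ ∈ Eido → A₂ ∈ Eido → B₁ ∈ Eido → B₂ ∈ Eido →
    Disjoint A₁ A₂ → Disjoint B₁ B₂ →
    (∀ a ∈ A₁ ∪ A₂, ∀ b ∈ A₁ ∪ A₂, Arrow {a} {b} ∨ Arrow {b} {a}) →
    (∀ a ∈ B₁ ∪ B₂, ∀ b ∈ B₁ ∪ B₂, Arrow {a} {b} ∨ Arrow {b} {a}) →
    Arrow A₁ B₁ → Arrow A₂ B₂ → Arrow (A₁ ∪ A₂) (B₁ ∪ B₂)

attribute [instance] EidoSys.decEq

namespace EidoSys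

variable (S : EidoSys)

/-- Combination of eidostates: the Cartesian product, realized via the pairing map. -/
def comb (A B : Finset S.State) : Finset S.State := Finset.image₂ S.pair A B

/-- The process (A,B) is possible: A ⇌ B. -/
def Pos (A B : Finset S.State) : Prop := S.Arrow A B ∨ S.Arrow B A

/-- A ↔ B. -/
def Rev (A B : Finset S.State) : Prop := S.Arrow A B ∧ S.Arrow B A

/-- Uniform eidostate. -/
def Uniform (A : Finset S.State) : Prop := A ∈ S.Eido ∧ ∀ a ∈ A, ∀ b ∈ A, S.Pos {a} {b}

/-- Record state: a ↔ a + r for some state a. -/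
def IsRecord (r : S.State) : Prop := ∃ a : S.State, S.Rev {a} (S.comb {a} {r})

/-- Information state: an eidostate all of whose elements are record states. -/
def IsInfo (I : Finset S.State) : Prop := I ∈ S.Eido ∧ ∀ r ∈ I, S.IsRecord r

/-- Bit state: an information state with exactly two elements. -/
def IsBit (I : Finset S.State) : Prop := S.IsInfo I ∧ I.card = 2

/-- Information axiom: there exist a bit state and a possible bit process. -/
def InfoAxiom : Prop := ∃ (r : S.State) (I : Finset S.State), S.IsRecord r ∧ S.IsBit I ∧ S.Pos {r} I

/-- Demon axiom. -/
def DemonAxiom : Prop := ∀ a b : S.State, ∀ J : Finset S.State, S.IsInfo J →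
    S.Arrow {a} (S.comb {b} J) →
    (∃ I : Finset S.State, S.IsInfo I ∧ S.Arrow {b} (S.comb {a} I)) ∧
    (∀ I : Finset S.State, S.IsInfo I → S.Arrow {a} (S.comb {b} I) ∨ S.Arrow (S.comb {b} I) {a})

/-- `copies A n` is the combination of `n+1` copies of `A` (so `copies A 0 = A`). -/
def copies (A : Finset S.State) : ℕ → Finset S.State
  | 0 => A
  | n + 1 => S.comb A (copies A n)

/-- Stability axiom: if nA → nB + J for arbitrarily large n, then A → B. -/
def StabilityAxiom : Prop := ∀ A B J : Finset S.State, A ∈ S.Eido → B ∈ S.Eido → S.IsInfo J →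
    (∀ N : ℕ, ∃ n ≥ N, S.Arrow (S.copies A n) (S.comb (S.copies B n) J)) → S.Arrow A B

/-- State-equivalence axiom. -/
def StateEquivAxiom : Prop := ∀ E : Finset S.State, S.Uniform E →
    ∃ e x y : S.State, S.Arrow {x} {y} ∧ S.Rev (S.comb E {x}) (S.comb {e} {y})

/-- `addCopies A B k` is A + k·B (k copies of B appended to A). -/
def addCopies (A B : Finset S.State) : ℕ → Finset S.State
  | 0 => A
  | k + 1 => S.comb (addCopies A B k) B

/-- A designated set of mechanical states. -/
def MechSet (M : Set S.State) : Prop :=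
  (∀ l ∈ M, ∀ m ∈ M, S.pair l m ∈ M) ∧
  (∀ l ∈ M, ∀ m ∈ M, S.Arrow {l} {m} → S.Arrow {m} {l})

/-- Component of content on uniform eidostates. -/
def IsCoCU (Q : Finset S.State → ℝ) : Prop :=
  (∀ E F : Finset S.State, S.Uniform E → S.Uniform F → Q (S.comb E F) = Q E + Q F) ∧
  (∀ E F : Finset S.State, S.Uniform E → S.Uniform F → S.Pos E F → Q E = Q F)

/-- Entropy function on the uniform eidostates (relative to mechanical states M). -/
def IsEntropyU (M : Set S.State) (Ent : Finset S.State → ℝ) : Prop :=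
  (∀ E F : Finset S.State, S.Uniform E → S.Uniform F → Ent (S.comb E F) = Ent E + Ent F) ∧
  (∀ E F : Finset S.State, S.Uniform E → S.Uniform F → S.Pos E F → (S.Arrow E F ↔ Ent E ≤ Ent F)) ∧
  (∀ m ∈ M, Ent {m} = 0) ∧
  (∀ I : Finset S.State, S.IsInfo I → Ent I = Real.logb 2 (I.card))

end EidoSys

namespace EidoSys

variable (S : EidoSys)

/-- Component of content on the states 𝒮: additive under +, conserved on possible
singleton processes. -/
def IsCoCS (Q : S.State → ℝ) : Prop :=
  (∀ a b : S.State, Q (S.pair a b) = Q a + Q b) ∧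
  (∀ a b : S.State, S.Pos {a} {b} → Q a = Q b)

end EidoSys

theorem baer_int_real : Module.Baer ℤ ℝ :=
  Module.Baer.of_divisible ℝ

/-- Real-valued homomorphisms vanishing on a subgroup with torsion-free quotient separate it from
every point outside it. -/
theorem AddSubgroup.exists_real_hom_ne_zero {G : Type*} [AddCommGroup G] (D : AddSubgroup G)
    (hD : ∀ (n : ℤ) (x : G), n ≠ 0 → n • x ∈ D → x ∈ D) {x : G} (hx : x ∉ D) :
    ∃ Q : G →+ ℝ, (∀ d ∈ D, Q d = 0) ∧ Q x ≠ 0 := by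
  have hinj : Function.Injective (zmultiplesHom (G ⧸ D) (x : G ⧸ D)) := by
    rw [injective_iff_map_eq_zero]
    intro n hn
    by_contra hne
    refine hx (hD n x hne ?_)
    rw [← QuotientAddGroup.eq_zero_iff]
    simpa using hn
  obtain ⟨h, hh⟩ := baer_int_real.extension_property_addMonoidHom _ hinj (Int.castAddHom ℝ)
  refine ⟨h.comp (QuotientAddGroup.mk' D), fun d hd => ?_, ?_⟩
  · simp [(QuotientAddGroup.eq_zero_iff d).2 hd]
  · have := DFunLike.congr_fun hh 1
    simp at this
    simp [this]

/-- In a partially ordered abelian group whose elements comparable to zero form an Archimedean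
subgroup `D`, there is a real homomorphism that detects the order on `D` and vanishes on a given
antichain subgroup. -/
theorem exists_real_hom_nonneg_iff {G : Type*} [AddCommGroup G] [PartialOrder G]
    [IsOrderedAddMonoid G] (D K : AddSubgroup G) (hD : ∀ x, x ∈ D ↔ 0 ≤ x ∨ x ≤ 0)
    (harch : ∀ x y : G, 0 ≤ x → 0 < y → ∃ n : ℕ, ¬ n • y ≤ x)
    (hK : ∀ x ∈ K, 0 ≤ x → x = 0) :
    ∃ E : G →+ ℝ, (∀ x ∈ D, 0 ≤ x ↔ 0 ≤ E x) ∧ ∀ x ∈ K, E x = 0 := by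
  classical
  have htot : ∀ x y : D, x ≤ y ∨ y ≤ x := fun x y => by
    rcases (hD _).1 (D.sub_mem y.2 x.2) with h | h
    · exact Or.inl (sub_nonneg.1 h)
    · exact Or.inr (sub_nonpos.1 h)
  let : LinearOrder D :=
    { (inferInstance : PartialOrder D) with
      le_total := htot
      toDecidableLE := Classical.decRel _ }
  have : IsOrderedAddMonoid D :=
    { add_le_add_left := fun a b h c => by
        have h' : (a : G) ≤ b := h
        exact add_le_add_left h' (c : G) }
  have : Archimedean D := by
    refine ⟨fun x y hy => ?_⟩
    rcases le_total 0 x with hx | hx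
    · obtain ⟨n, hn⟩ := harch x y hx hy
      refine ⟨n, (htot x (n • y)).resolve_right fun h => hn ?_⟩
      simpa using (show ((n • y : D) : G) ≤ x from h)
    · exact ⟨0, by simpa using hx⟩
  obtain ⟨f, hf⟩ := Archimedean.exists_orderAddMonoidHom_real_injective D
  have hinj : Function.Injective ((QuotientAddGroup.mk' K).comp D.subtype) := by
    rw [injective_iff_map_eq_zero]
    rintro ⟨x, hx⟩ h
    have hxK : x ∈ K := (QuotientAddGroup.eq_zero_iff x).1 h
    apply Subtype.ext
    rcases (hD x).1 hx with h0 | h0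
    · exact hK x hxK h0
    · exact neg_eq_zero.1 (hK (-x) (K.neg_mem hxK) (neg_nonneg.2 h0))
  obtain ⟨h, hh⟩ := baer_int_real.extension_property_addMonoidHom _ hinj (f : D →+ ℝ)
  refine ⟨h.comp (QuotientAddGroup.mk' K), fun x hx => ?_, fun x hx => ?_⟩
  · have hxf : h (QuotientAddGroup.mk' K x) = f ⟨x, hx⟩ := DFunLike.congr_fun hh ⟨x, hx⟩
    have hmono : StrictMono f := f.monotone'.strictMono_of_injective hf
    rw [AddMonoidHom.comp_apply, hxf, ← map_zero f, hmono.le_iff_le]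
    rfl
  · simp [(QuotientAddGroup.eq_zero_iff x).2 hx]

open Algebra (GrothendieckAddGroup) in
theorem GrothendieckAddGroup.exists_sub {N : Type*} [AddCommMonoid N]
    (x : GrothendieckAddGroup N) :
    ∃ a b : N, x = GrothendieckAddGroup.of b - GrothendieckAddGroup.of a := by
  induction x using AddLocalization.ind with
  | H y =>
    obtain ⟨b, a⟩ := y
    refine ⟨a, b, ?_⟩
    simp only [GrothendieckAddGroup.of, AddSubmonoid.LocalizationMap.toAddMonoidHom_apply,
      ← AddLocalization.mk_zero_eq_addMonoidOf_mk]
    rw [Algebra.GrothendieckAddGroup.mk_sub_mk]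
    simp

open Algebra (GrothendieckAddGroup) in
theorem GrothendieckAddGroup.of_le_of {N : Type*} [AddCommMonoid N] [PartialOrder N]
    [IsOrderedCancelAddMonoid N] {a b : N} :
    GrothendieckAddGroup.of a ≤ GrothendieckAddGroup.of b ↔ a ≤ b := by
  simp only [GrothendieckAddGroup.of, AddSubmonoid.LocalizationMap.toAddMonoidHom_apply,
    ← AddLocalization.mk_zero_eq_addMonoidOf_mk, AddLocalization.mk_le_mk]
  simp

open Algebra (GrothendieckAddGroup) in
/-- Entropy and components of content for an ordered cancellative monoid. -/
theorem exists_entropy_and_content {N : Type*} [AddCommMonoid N] [PartialOrder N]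
    [IsOrderedCancelAddMonoid N]
    (hcomp : ∀ a b c d : N, a ≤ b → d ≤ c → a + c ≤ b + d ∨ b + d ≤ a + c)
    (htors : ∀ (n : ℕ) (a b : N), n ≠ 0 → n • a ≤ n • b → a ≤ b)
    (harch : ∀ a b c d : N, c ≤ d → (∀ n : ℕ, c + n • b ≤ d + n • a) → b ≤ a)
    (M : AddSubmonoid N) (hM : ∀ l ∈ M, ∀ m ∈ M, l ≤ m → m ≤ l) :
    ∃ (E : N →+ ℝ) (Qs : Set (N →+ ℝ)), (∀ Q ∈ Qs, ∀ a b, a ≤ b → Q a = Q b) ∧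
      (∀ a b, a ≤ b ↔ E a ≤ E b ∧ ∀ Q ∈ Qs, Q a = Q b) ∧ ∀ m ∈ M, E m = 0 := by
  let ι : N →+ GrothendieckAddGroup N := GrothendieckAddGroup.of
  have hι : ∀ {a b : N}, ι a ≤ ι b ↔ a ≤ b := GrothendieckAddGroup.of_le_of
  have hrep : ∀ x, ∃ a b, x = ι b - ι a := GrothendieckAddGroup.exists_sub
  clear_value ι
  have : IsOrderedAddMonoid (GrothendieckAddGroup N) :=
    IsOrderedCancelAddMonoid.toIsOrderedAddMonoid
  have hnn : ∀ {a b : N}, 0 ≤ ι b - ι a ↔ a ≤ b := by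
    intro a b; rw [sub_nonneg, hι]
  have hnp : ∀ {a b : N}, ι b - ι a ≤ 0 ↔ b ≤ a := by
    intro a b; rw [sub_nonpos, hι]
  let D : AddSubgroup (GrothendieckAddGroup N) :=
    { carrier := {x | 0 ≤ x ∨ x ≤ 0}
      zero_mem' := Or.inl le_rfl
      neg_mem' := by
        rintro x (h | h)
        · exact Or.inr (neg_nonpos.2 h)
        · exact Or.inl (neg_nonneg.2 h)
      add_mem' := by
        have key : ∀ x y : GrothendieckAddGroup N, 0 ≤ x → y ≤ 0 → 0 ≤ x + y ∨ x + y ≤ 0 := by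
          intro x y hx hy
          obtain ⟨a, b, rfl⟩ := hrep x
          obtain ⟨c, d, rfl⟩ := hrep y
          have e : ι b - ι a + (ι d - ι c) = ι (b + d) - ι (a + c) := by
            rw [map_add, map_add]; abel
          rw [e, hnn, hnp]
          exact hcomp a b c d (hnn.1 hx) (hnp.1 hy)
        rintro x y (hx | hx) (hy | hy)
        · exact Or.inl (add_nonneg hx hy)
        · exact key x y hx hy
        · rw [add_comm]
          exact key y x hy hx
        · exact Or.inr (add_nonpos hx hy) }
  have hD : ∀ x, x ∈ D ↔ 0 ≤ x ∨ x ≤ 0 := fun x => Iff.rfl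
  let K : AddSubgroup (GrothendieckAddGroup N) :=
    { carrier := {x | ∃ l ∈ M, ∃ m ∈ M, x = ι m - ι l}
      zero_mem' := ⟨0, M.zero_mem, 0, M.zero_mem, by simp⟩
      neg_mem' := by
        rintro _ ⟨l, hl, m, hm, rfl⟩
        exact ⟨m, hm, l, hl, by simp⟩
      add_mem' := by
        rintro _ _ ⟨l, hl, m, hm, rfl⟩ ⟨l', hl', m', hm', rfl⟩
        exact ⟨l + l', M.add_mem hl hl', m + m', M.add_mem hm hm', by
          rw [map_add, map_add]; abel⟩ }
  have hK : ∀ x ∈ K, 0 ≤ x → x = 0 := by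
    rintro _ ⟨l, hl, m, hm, rfl⟩ h
    exact le_antisymm (hnp.2 (hM l hl m hm (hnn.1 h))) h
  have htorsD : ∀ (n : ℤ) (x : GrothendieckAddGroup N), n ≠ 0 → n • x ∈ D → x ∈ D := by
    intro n x hn h
    have h' : n.natAbs • x ∈ D := by
      rcases Int.natAbs_eq n with e | e
      · rwa [e, natCast_zsmul] at h
      · rw [e, neg_zsmul, natCast_zsmul] at h
        exact D.neg_mem_iff.1 h
    obtain ⟨a, b, rfl⟩ := hrep x
    rw [nsmul_sub, ← map_nsmul, ← map_nsmul, hD, hnn, hnp] at h'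
    rw [hD, hnn, hnp]
    exact h'.imp (htors _ a b (Int.natAbs_ne_zero.2 hn)) (htors _ b a (Int.natAbs_ne_zero.2 hn))
  obtain ⟨E, hE, hEK⟩ := exists_real_hom_nonneg_iff D K hD (fun x y hx hy => by
    by_contra! hcon
    obtain ⟨c, d, rfl⟩ := hrep x
    obtain ⟨a, b, rfl⟩ := hrep y
    refine hy.not_ge (hnp.2 (harch a b c d (hnn.1 hx) fun n => ?_))
    have := hcon n
    rw [← sub_nonneg] at this
    have e : ι d - ι c - n • (ι b - ι a) = ι (d + n • a) - ι (c + n • b) := by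
      rw [map_add, map_add, map_nsmul, map_nsmul, nsmul_sub]
      abel
    rwa [e, hnn] at this) hK
  refine ⟨E.comp ι, {Q | ∃ q : GrothendieckAddGroup N →+ ℝ, (∀ d ∈ D, q d = 0) ∧ Q = q.comp ι},
    ?_, fun a b => ⟨fun h => ⟨?_, ?_⟩, ?_⟩, fun m hm => ?_⟩
  · rintro _ ⟨q, hq, rfl⟩ a b h
    have := hq (ι b - ι a) (Or.inl (hnn.2 h))
    rw [map_sub, sub_eq_zero] at this
    exact this.symm
  · have := (hE _ (Or.inl (hnn.2 h))).1 (hnn.2 h)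
    rwa [map_sub, sub_nonneg] at this
  · rintro _ ⟨q, hq, rfl⟩
    have := hq (ι b - ι a) (Or.inl (hnn.2 h))
    rw [map_sub, sub_eq_zero] at this
    exact this.symm
  · rintro ⟨h, hQ⟩
    have hmem : ι b - ι a ∈ D := by
      by_contra hx
      obtain ⟨q, hq, hne⟩ := D.exists_real_hom_ne_zero htorsD hx
      apply hne
      rw [map_sub, sub_eq_zero]
      exact (hQ _ ⟨q, hq, rfl⟩).symm
    rw [← hnn, hE _ hmem, map_sub, sub_nonneg]
    exact h
  · exact hEK _ ⟨0, M.zero_mem, m, hm, by simp⟩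

namespace EidoSys

variable (S : EidoSys)

theorem comb_singleton (a b : S.State) : S.comb {a} {b} = {S.pair a b} :=
  Finset.image₂_singleton

theorem arrow_pair_comm (a b : S.State) : S.Arrow {S.pair a b} {S.pair b a} := by
  have h := S.sim_comm {a} {b}
  simp only [Finset.image₂_singleton] at h
  exact S.arrow_of_sim _ _ (S.singleton_mem _) (S.singleton_mem _) h

theorem sim_pair_assoc (a b c : S.State) :
    S.Sim {S.pair (S.pair a b) c} {S.pair a (S.pair b c)} := by
  have h := S.sim_assoc {a} {b} {c}
  simpa only [Finset.image₂_singleton] using h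

theorem arrow_pair_right {a b : S.State} (h : S.Arrow {a} {b}) (c : S.State) :
    S.Arrow {S.pair a c} {S.pair b c} := by
  have := S.arrow_comb _ _ {c} h
  simpa only [Finset.image₂_singleton] using this

theorem arrow_of_pair_right {a b c : S.State} (h : S.Arrow {S.pair a c} {S.pair b c}) :
    S.Arrow {a} {b} := by
  apply S.arrow_cancel {a} {b} c
  simpa only [Finset.image₂_singleton] using h

instance : Preorder S.State where
  le a b := S.Arrow {a} {b}
  le_refl a := S.arrow_of_sim _ _ (S.singleton_mem _) (S.singleton_mem _) (S.sim_refl _)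
  le_trans _ _ _ := S.arrow_trans _ _ _

theorem pair_mono {a b c d : S.State} (h : a ≤ b) (h' : c ≤ d) : S.pair a c ≤ S.pair b d :=
  S.arrow_trans _ _ _ (S.arrow_pair_right h c) <|
  S.arrow_trans _ _ _ (S.arrow_pair_comm b c) <|
  S.arrow_trans _ _ _ (S.arrow_pair_right h' b) (S.arrow_pair_comm d b)

/-- States up to reversible transformation. -/
def StateClass : Type := Antisymmetrization S.State (· ≤ ·)

instance : PartialOrder S.StateClass :=
  inferInstanceAs (PartialOrder (Antisymmetrization S.State (· ≤ ·)))

/-- The class of a state. -/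
def cls (a : S.State) : S.StateClass := toAntisymmetrization (· ≤ ·) a

theorem cls_le_cls {a b : S.State} : S.cls a ≤ S.cls b ↔ S.Arrow {a} {b} := Iff.rfl

theorem cls_surjective (x : S.StateClass) : ∃ a, S.cls a = x :=
  Quotient.exists_rep x

instance : Add S.StateClass :=
  ⟨Quotient.map₂ S.pair fun _ _ h _ _ h' => ⟨S.pair_mono h.1 h'.1, S.pair_mono h.2 h'.2⟩⟩

theorem cls_pair (a b : S.State) : S.cls (S.pair a b) = S.cls a + S.cls b := rfl

instance : AddCommSemigroup S.StateClass where
  add_assoc x y z := by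
    obtain ⟨a, rfl⟩ := S.cls_surjective x
    obtain ⟨b, rfl⟩ := S.cls_surjective y
    obtain ⟨c, rfl⟩ := S.cls_surjective z
    have h := S.sim_pair_assoc a b c
    exact le_antisymm
      (S.arrow_of_sim _ _ (S.singleton_mem _) (S.singleton_mem _) h)
      (S.arrow_of_sim _ _ (S.singleton_mem _) (S.singleton_mem _) (S.sim_symm _ _ h))
  add_comm x y := by
    obtain ⟨a, rfl⟩ := S.cls_surjective x
    obtain ⟨b, rfl⟩ := S.cls_surjective y
    exact le_antisymm (S.arrow_pair_comm a b) (S.arrow_pair_comm b a)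

theorem cls_add_le_add_iff_right {x y : S.StateClass} (z : S.StateClass) :
    x + z ≤ y + z ↔ x ≤ y := by
  obtain ⟨a, rfl⟩ := S.cls_surjective x
  obtain ⟨b, rfl⟩ := S.cls_surjective y
  obtain ⟨c, rfl⟩ := S.cls_surjective z
  exact ⟨S.arrow_of_pair_right, fun h => S.arrow_pair_right h c⟩

theorem IsRecord.add_cls {S : EidoSys} {r : S.State} (hr : S.IsRecord r) (x : S.StateClass) :
    x + S.cls r = x := by
  obtain ⟨a, h₁, h₂⟩ := hr
  rw [S.comb_singleton] at h₁ h₂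
  have h : S.cls a + S.cls r = S.cls a := le_antisymm h₂ h₁
  have e : x + S.cls r + S.cls a = x + S.cls a := by
    rw [add_assoc, add_comm (S.cls r), h]
  exact le_antisymm ((S.cls_add_le_add_iff_right _).1 e.le)
    ((S.cls_add_le_add_iff_right _).1 e.ge)

/-- A record state acts as zero on state classes. -/
@[reducible]
def addCommMonoidOfRecord {r : S.State} (hr : S.IsRecord r) : AddCommMonoid S.StateClass :=
  { (inferInstance : AddCommSemigroup S.StateClass) with
    zero := S.cls r
    add_zero := hr.add_cls
    zero_add := fun x => (add_comm _ _).trans (hr.add_cls x)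
    nsmul := @nsmulRec _ ⟨S.cls r⟩ _ }

theorem IsRecord.isInfo_singleton {S : EidoSys} {r : S.State} (hr : S.IsRecord r) :
    S.IsInfo {r} :=
  ⟨S.singleton_mem r, fun s hs => by rwa [Finset.mem_singleton.1 hs]⟩

theorem arrow_comb_left {A B : Finset S.State} (C : Finset S.State)
    (hA : A ∈ S.Eido) (hB : B ∈ S.Eido) (hC : C ∈ S.Eido) (h : S.Arrow A B) :
    S.Arrow (S.comb C A) (S.comb C B) :=
  S.arrow_trans _ _ _
    (S.arrow_of_sim _ _ ((S.comb_mem _ _).2 ⟨hC, hA⟩) ((S.comb_mem _ _).2 ⟨hA, hC⟩)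
      (S.sim_comm _ _)) <|
  S.arrow_trans _ _ _ (S.arrow_comb _ _ C h) <|
    S.arrow_of_sim _ _ ((S.comb_mem _ _).2 ⟨hB, hC⟩) ((S.comb_mem _ _).2 ⟨hC, hB⟩)
      (S.sim_comm _ _)

/-- Adding a further state to a process that yields an information state. -/
theorem arrow_pair_comb {a b : S.State} {I : Finset S.State} (hI : I ∈ S.Eido)
    (h : S.Arrow {a} (S.comb {b} I)) (c : S.State) :
    S.Arrow {S.pair c a} (S.comb {S.pair c b} I) := by
  have h₁ := S.arrow_comb_left {c} (S.singleton_mem a)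
    ((S.comb_mem _ _).2 ⟨S.singleton_mem b, hI⟩) (S.singleton_mem c) h
  rw [S.comb_singleton] at h₁
  refine S.arrow_trans _ _ _ h₁ ?_
  have h₂ := S.sim_symm _ _ (S.sim_assoc {c} {b} I)
  have hm : S.comb (S.comb {c} {b}) I ∈ S.Eido :=
    (S.comb_mem _ _).2 ⟨(S.comb_mem _ _).2 ⟨S.singleton_mem c, S.singleton_mem b⟩, hI⟩
  have hm' : S.comb {c} (S.comb {b} I) ∈ S.Eido :=
    (S.comb_mem _ _).2 ⟨S.singleton_mem c, (S.comb_mem _ _).2 ⟨S.singleton_mem b, hI⟩⟩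
  rw [← S.comb_singleton]
  exact S.arrow_of_sim _ _ hm' hm h₂

theorem arrow_of_pair_comb {a b c : S.State} {I : Finset S.State} (hI : I ∈ S.Eido)
    (h : S.Arrow {S.pair a c} (S.comb {S.pair b c} I)) : S.Arrow {a} (S.comb {b} I) := by
  have hb := S.singleton_mem b
  have hc := S.singleton_mem c
  have hcI : S.comb {c} I ∈ S.Eido := (S.comb_mem _ _).2 ⟨hc, hI⟩
  have hIc : S.comb I {c} ∈ S.Eido := (S.comb_mem _ _).2 ⟨hI, hc⟩
  have hbI : S.comb {b} I ∈ S.Eido := (S.comb_mem _ _).2 ⟨hb, hI⟩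
  apply S.arrow_cancel {a} (S.comb {b} I) c
  rw [Finset.image₂_singleton]
  refine S.arrow_trans _ _ _ h ?_
  rw [← S.comb_singleton]
  refine S.arrow_trans _ (S.comb {b} (S.comb {c} I)) _
    (S.arrow_of_sim _ _ ((S.comb_mem _ _).2 ⟨(S.comb_mem _ _).2 ⟨hb, hc⟩, hI⟩)
      ((S.comb_mem _ _).2 ⟨hb, hcI⟩) (S.sim_assoc _ _ _)) ?_
  refine S.arrow_trans _ (S.comb {b} (S.comb I {c})) _
    (S.arrow_comb_left _ hcI hIc hb (S.arrow_of_sim _ _ hcI hIc (S.sim_comm _ _))) ?_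
  exact S.arrow_of_sim _ _ ((S.comb_mem _ _).2 ⟨hb, hIc⟩) ((S.comb_mem _ _).2 ⟨hbI, hc⟩)
    (S.sim_symm _ _ (S.sim_assoc _ _ _))

theorem DemonAxiom.exists_isInfo_of_arrow {S : EidoSys} (hdemon : S.DemonAxiom) {r : S.State}
    (hr : S.IsRecord r) {a b : S.State} (h : S.Arrow {a} {b}) :
    ∃ I, S.IsInfo I ∧ S.Arrow {b} (S.comb {a} I) := by
  refine (hdemon a b {r} hr.isInfo_singleton ?_).1
  rw [S.comb_singleton, ← S.cls_le_cls, S.cls_pair, hr.add_cls]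
  exact h

theorem DemonAxiom.cls_comparable {S : EidoSys} (hdemon : S.DemonAxiom) {r : S.State}
    (hr : S.IsRecord r) {x y z w : S.StateClass} (h : x ≤ y) (h' : w ≤ z) :
    x + z ≤ y + w ∨ y + w ≤ x + z := by
  obtain ⟨a, rfl⟩ := S.cls_surjective x
  obtain ⟨b, rfl⟩ := S.cls_surjective y
  obtain ⟨c, rfl⟩ := S.cls_surjective z
  obtain ⟨d, rfl⟩ := S.cls_surjective w
  obtain ⟨I, hI, hIa⟩ := hdemon.exists_isInfo_of_arrow hr h'
  have h₁ : S.Arrow {S.pair a c} (S.comb {S.pair b d} I) :=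
    S.arrow_trans _ _ _ (S.arrow_pair_right h c) (S.arrow_pair_comb hI.1 hIa b)
  have h₂ := (hdemon _ _ I hI h₁).2 {r} hr.isInfo_singleton
  rw [S.comb_singleton] at h₂
  simpa only [← S.cls_le_cls, S.cls_pair, hr.add_cls] using h₂

theorem exists_copies_singleton {r : S.State} (hr : S.IsRecord r) (a : S.State) (n : ℕ) :
    let := S.addCommMonoidOfRecord hr
    ∃ m, S.copies {a} n = {m} ∧ S.cls m = (n + 1) • S.cls a := by
  let := S.addCommMonoidOfRecord hr
  induction n with
  | zero => exact ⟨a, rfl, by rw [zero_add, one_nsmul]⟩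
  | succ n ih =>
    obtain ⟨m, hm, hm'⟩ := ih
    refine ⟨S.pair a m, ?_, ?_⟩
    · rw [copies, hm, comb_singleton]
    · rw [succ_nsmul', ← hm']
      rfl

end EidoSys

/-- There exist an entropy function 𝕊 and a set 𝒬 of components of content on
𝒮 with: (a) 𝕊 additive; (b) every Q ∈ 𝒬 additive; (c) a → b iff 𝕊(a) ≤ 𝕊(b) and
Q(a) = Q(b) for every Q ∈ 𝒬; (d) 𝕊(m) = 0 for every mechanical state m. -/
theorem stmt11 (S : EidoSys) (hinfo : S.InfoAxiom) (hdemon : S.DemonAxiom)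
    (hstab : S.StabilityAxiom) (M : Set S.State) (hM : S.MechSet M) :
    ∃ (Ent : S.State → ℝ) (Qs : Set (S.State → ℝ)),
      (∀ Q ∈ Qs, S.IsCoCS Q) ∧
      (∀ a b : S.State, Ent (S.pair a b) = Ent a + Ent b) ∧
      (∀ Q ∈ Qs, ∀ a b : S.State, Q (S.pair a b) = Q a + Q b) ∧
      (∀ a b : S.State, S.Arrow {a} {b} ↔ (Ent a ≤ Ent b ∧ ∀ Q ∈ Qs, Q a = Q b)) ∧
      (∀ m ∈ M, Ent m = 0) := by
  obtain ⟨r, -, hr, -⟩ := hinfo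
  let := S.addCommMonoidOfRecord hr
  have hzero : S.cls r = 0 := rfl
  have : IsOrderedCancelAddMonoid S.StateClass :=
    { add_le_add_left := fun a b h c => (S.cls_add_le_add_iff_right c).2 h
      le_of_add_le_add_left := fun a b c h => by
        rw [add_comm a, add_comm a] at h
        exact (S.cls_add_le_add_iff_right a).1 h }
  have hstab_info : ∀ (a b : S.State) (I : Finset S.State), S.IsInfo I →
      (∀ N, ∃ n ≥ N, ∀ p q, S.cls p = (n + 1) • S.cls a → S.cls q = (n + 1) • S.cls b →
        S.Arrow {p} (S.comb {q} I)) → S.Arrow {a} {b} := by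
    intro a b I hI h
    refine hstab {a} {b} I (S.singleton_mem a) (S.singleton_mem b) hI fun N => ?_
    obtain ⟨n, hn, hpq⟩ := h N
    obtain ⟨p, hp, hp'⟩ := S.exists_copies_singleton hr a n
    obtain ⟨q, hq, hq'⟩ := S.exists_copies_singleton hr b n
    exact ⟨n, hn, by rw [hp, hq]; exact hpq p q hp' hq'⟩
  let MC : AddSubmonoid S.StateClass :=
    { carrier := {x | x = 0 ∨ ∃ m ∈ M, S.cls m = x}
      zero_mem' := Or.inl rfl
      add_mem' := by
        rintro x y (rfl | ⟨m, hm, rfl⟩) (rfl | ⟨l, hl, rfl⟩)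
        · exact Or.inl (add_zero _)
        · exact Or.inr ⟨l, hl, (zero_add _).symm⟩
        · exact Or.inr ⟨m, hm, (add_zero _).symm⟩
        · exact Or.inr ⟨_, hM.1 m hm l hl, rfl⟩ }
  have hanti : ∀ l ∈ M, ∀ m ∈ M, S.cls l ≤ S.cls m → S.cls m ≤ S.cls l := hM.2
  obtain ⟨E, Qs, hQs, hEQ, hE⟩ := exists_entropy_and_content (N := S.StateClass)
    (fun a b c d h h' => hdemon.cls_comparable hr h h')
    (by
      intro n x y hn h
      obtain ⟨a, rfl⟩ := S.cls_surjective x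
      obtain ⟨b, rfl⟩ := S.cls_surjective y
      refine hstab_info a b {r} hr.isInfo_singleton fun N => ⟨n * (N + 1) - 1, ?_, ?_⟩
      · have : N + 1 ≤ n * (N + 1) := Nat.le_mul_of_pos_left _ (Nat.pos_of_ne_zero hn)
        omega
      · intro p q hp hq
        have e : n * (N + 1) - 1 + 1 = n * (N + 1) :=
          Nat.sub_add_cancel (Nat.mul_pos (Nat.pos_of_ne_zero hn) N.succ_pos)
        rw [e] at hp hq
        rw [S.comb_singleton, ← S.cls_le_cls, S.cls_pair, hzero, add_zero, hp, hq, mul_nsmul,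
          mul_nsmul]
        exact nsmul_le_nsmul_right h _)
    (by
      intro x y z w hzw h
      obtain ⟨a, rfl⟩ := S.cls_surjective x
      obtain ⟨b, rfl⟩ := S.cls_surjective y
      obtain ⟨c, rfl⟩ := S.cls_surjective z
      obtain ⟨d, rfl⟩ := S.cls_surjective w
      obtain ⟨I, hI, hIc⟩ := hdemon.exists_isInfo_of_arrow hr hzw
      refine hstab_info b a I hI fun N => ⟨N, le_rfl, fun p q hp hq => ?_⟩
      have h₁ : S.Arrow {S.pair p c} {S.pair q d} := by
        rw [← S.cls_le_cls, S.cls_pair, S.cls_pair, hp, hq, add_comm, add_comm _ (S.cls d)]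
        exact h (N + 1)
      exact S.arrow_of_pair_comb hI.1
        (S.arrow_trans _ _ _ h₁ (S.arrow_pair_comb hI.1 hIc q)))
    MC
    (by
      rintro _ (rfl | ⟨l, hl, rfl⟩) _ (rfl | ⟨m, hm, rfl⟩) h
      · exact le_rfl
      · have := hanti m hm (S.pair m m) (hM.1 m hm m hm) (by
          rw [S.cls_pair]; exact le_add_of_nonneg_left h)
        rw [S.cls_pair] at this
        exact add_le_iff_nonpos_left.1 this
      · have := hanti (S.pair l l) (hM.1 l hl l hl) l hl (by
          rw [S.cls_pair]; exact add_le_iff_nonpos_left.2 h)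
        rw [S.cls_pair] at this
        exact (le_add_iff_nonneg_left _).1 this
      · exact hanti l hl m hm h)
  refine ⟨fun a => E (S.cls a), {q | ∃ Q ∈ Qs, q = fun a => Q (S.cls a)}, ?_, ?_, ?_, ?_, ?_⟩
  · rintro _ ⟨Q, hQ, rfl⟩
    refine ⟨fun a b => map_add Q (S.cls a) (S.cls b), ?_⟩
    rintro a b (h | h)
    · exact hQs Q hQ _ _ h
    · exact (hQs Q hQ _ _ h).symm
  · exact fun a b => map_add E (S.cls a) (S.cls b)
  · rintro _ ⟨Q, hQ, rfl⟩ a b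
    exact map_add Q (S.cls a) (S.cls b)
  · intro a b
    rw [← S.cls_le_cls, hEQ]
    refine and_congr_right fun _ => ⟨?_, fun h Q hQ => h _ ⟨Q, hQ, rfl⟩⟩
    rintro h _ ⟨Q, hQ, rfl⟩
    exact h Q hQ
  · exact fun m hm => hE _ (Or.inr ⟨m, hm, rfl⟩)
end

section
/- Landauer's principle in the axiomatic framework: if a and b are states and I_b is a bit state such that a + I_b → b, then 𝕊(b) ≥ 𝕊(a) + 1 for any entropy function 𝕊 on the uniform eidostates. -/
namespace EidoSys

variable (S : EidoSys)

theorem arrow_pair_comm_s18 (x y : S.State) : S.Arrow {S.pair x y} {S.pair y x} := by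
  have h := S.sim_comm {x} {y}
  simp only [Finset.image₂_singleton] at h
  exact S.arrow_of_sim _ _ (S.singleton_mem _) (S.singleton_mem _) h

theorem arrow_pair_assoc (x y z : S.State) :
    S.Arrow {S.pair (S.pair x y) z} {S.pair x (S.pair y z)} := by
  have h := S.sim_assoc {x} {y} {z}
  simp only [Finset.image₂_singleton] at h
  exact S.arrow_of_sim _ _ (S.singleton_mem _) (S.singleton_mem _) h

theorem arrow_pair_assoc_symm (x y z : S.State) :
    S.Arrow {S.pair x (S.pair y z)} {S.pair (S.pair x y) z} := by
  have h := S.sim_symm _ _ (S.sim_assoc {x} {y} {z})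
  simp only [Finset.image₂_singleton] at h
  exact S.arrow_of_sim _ _ (S.singleton_mem _) (S.singleton_mem _) h

variable {S}

theorem Arrow.pair_right {x y : S.State} (h : S.Arrow {x} {y}) (z : S.State) :
    S.Arrow {S.pair x z} {S.pair y z} := by
  simpa only [Finset.image₂_singleton] using S.arrow_comb _ _ {z} h

theorem Arrow.pair_left {x y : S.State} (h : S.Arrow {x} {y}) (z : S.State) :
    S.Arrow {S.pair z x} {S.pair z y} :=
  S.arrow_trans _ _ _ (S.arrow_pair_comm_s18 z x)
    (S.arrow_trans _ _ _ (Arrow.pair_right h z) (S.arrow_pair_comm_s18 y z))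

/-- Any record state can be turned into any other one. -/
theorem IsRecord.arrow {r s : S.State} (hr : S.IsRecord r) (hs : S.IsRecord s) :
    S.Arrow {r} {s} := by
  obtain ⟨c, -, hc⟩ := hr
  obtain ⟨d, hd, -⟩ := hs
  simp only [comb, Finset.image₂_singleton] at hc hd
  apply S.arrow_cancel _ _ (S.pair c d)
  simp only [Finset.image₂_singleton]
  have trans {x y z : S.State} : S.Arrow {x} {y} → S.Arrow {y} {z} → S.Arrow {x} {z} :=
    S.arrow_trans _ _ _
  have erase : S.Arrow {S.pair r (S.pair c d)} {S.pair d c} :=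
    trans (S.arrow_pair_comm_s18 _ _) <| trans (Arrow.pair_right (S.arrow_pair_comm_s18 _ _) _) <|
      trans (S.arrow_pair_assoc _ _ _) (Arrow.pair_left hc _)
  have write : S.Arrow {S.pair d c} {S.pair s (S.pair c d)} :=
    trans (Arrow.pair_right hd _) <| trans (S.arrow_pair_comm_s18 _ _) <|
      trans (S.arrow_pair_assoc_symm _ _ _) (S.arrow_pair_comm_s18 _ _)
  exact trans erase write

theorem IsInfo.uniform {I : Finset S.State} (hI : S.IsInfo I) : S.Uniform I :=
  ⟨hI.1, fun r hr s hs => Or.inl (IsRecord.arrow (hI.2 r hr) (hI.2 s hs))⟩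

theorem uniform_singleton (a : S.State) : S.Uniform {a} := by
  refine ⟨S.singleton_mem a, fun x hx y hy => Or.inl ?_⟩
  rw [Finset.mem_singleton.mp hx, Finset.mem_singleton.mp hy]
  exact S.arrow_of_sim _ _ (S.singleton_mem a) (S.singleton_mem a) (S.sim_refl _)

theorem Uniform.comb_singleton {A : Finset S.State} (hA : S.Uniform A) (a : S.State) :
    S.Uniform (S.comb {a} A) := by
  refine ⟨(S.comb_mem _ _).mpr ⟨S.singleton_mem a, hA.1⟩, fun x hx y hy => ?_⟩
  simp only [comb, Finset.image₂_singleton_left, Finset.mem_image] at hx hy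
  obtain ⟨r, hr, rfl⟩ := hx
  obtain ⟨s, hs, rfl⟩ := hy
  exact (hA.2 r hr s hs).imp (Arrow.pair_left · a) (Arrow.pair_left · a)

end EidoSys

/-- Landauer's principle: if a + I_b → b for a bit state I_b, then
𝕊(b) ≥ 𝕊(a) + 1 for any entropy function 𝕊 on the uniform eidostates. -/
theorem stmt18 (S : EidoSys) (hinfo : S.InfoAxiom) (hdemon : S.DemonAxiom)
    (hstab : S.StabilityAxiom) (hse : S.StateEquivAxiom)
    (M : Set S.State) (hM : S.MechSet M)
    (Ent : Finset S.State → ℝ) (hEnt : S.IsEntropyU M Ent)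
    (a b : S.State) (Ib : Finset S.State) (hIb : S.IsBit Ib)
    (h : S.Arrow (S.comb {a} Ib) {b}) :
    Ent {b} ≥ Ent {a} + 1 := by
  obtain ⟨hadd, hmono, -, hlog⟩ := hEnt
  have hU := hIb.1.uniform
  have hbit : Ent Ib = 1 := by
    rw [hlog Ib hIb.1, hIb.2]
    exact Real.logb_self_eq_one one_lt_two
  have hle := (hmono _ _ (hU.comb_singleton a) (EidoSys.uniform_singleton b) (Or.inl h)).mp h
  rwa [hadd _ _ (EidoSys.uniform_singleton a) hU, hbit] at hle
end
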